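/- arXiv:1207.6851 — 10 statements merged into one kernel-verified Lean document; each statement's English description precedes it below -/
import Mathlib

section
/- Suppose r = 1, so that (Ψ y)(x) = y'(x) + s(x) y(x). Then for every n ≥ 1 and every smooth function y : ℝ → ℝ, Ψ^n y = y^{(n)} + ∑_{j=1}^{n} (binom(n, j) · Ψ^{j-1} s) · y^{(n-j)}, where Ψ^{j-1} s denotes the (j-1)-fold iterate of Ψ applied to the function s. -/
/-- The first-order differential operator `Ψ y = y' + s·y` (the case `r = 1`). -/
noncomputable def Psi1 (s : ℝ → ℝ) (y : ℝ → ℝ) : ℝ → ℝ :=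
  fun x => deriv y x + s x * y x

theorem ContDiff.psi1 {s u : ℝ → ℝ} (hs : ContDiff ℝ (⊤ : ℕ∞) s)
    (hu : ContDiff ℝ (⊤ : ℕ∞) u) : ContDiff ℝ (⊤ : ℕ∞) (Psi1 s u) :=
  (contDiff_infty_iff_deriv.mp hu).2.add (hs.mul hu)

theorem ContDiff.psi1_iterate {s u : ℝ → ℝ} (hs : ContDiff ℝ (⊤ : ℕ∞) s)
    (hu : ContDiff ℝ (⊤ : ℕ∞) u) (n : ℕ) : ContDiff ℝ (⊤ : ℕ∞) ((Psi1 s)^[n] u) := by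
  induction n with
  | zero => exact hu
  | succ n ih => rw [Function.iterate_succ_apply']; exact hs.psi1 ih

/-- Leibniz rule for the iterates of `Psi1 s`. -/
theorem psi1_iterate_mul {s u y : ℝ → ℝ} (hs : ContDiff ℝ (⊤ : ℕ∞) s)
    (hu : ContDiff ℝ (⊤ : ℕ∞) u) (hy : ContDiff ℝ (⊤ : ℕ∞) y) (n : ℕ) :
    (Psi1 s)^[n] (fun x => u x * y x) = fun x => ∑ p ∈ Finset.HasAntidiagonal.antidiagonal n,
      (n.choose p.1 : ℝ) * ((Psi1 s)^[p.1] u x * iteratedDeriv p.2 y x) := by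
  induction n with
  | zero => simp
  | succ n ih =>
    rw [Function.iterate_succ_apply', ih]
    funext x
    have hu' (i : ℕ) : HasDerivAt ((Psi1 s)^[i] u) (deriv ((Psi1 s)^[i] u) x) x :=
      ((hs.psi1_iterate hu i).differentiable (by simp) x).hasDerivAt
    have hy' (i : ℕ) : HasDerivAt (iteratedDeriv i y) (iteratedDeriv (i + 1) y x) x := by
      rw [iteratedDeriv_succ]
      exact (hy.differentiable_iteratedDeriv i (mod_cast WithTop.coe_lt_top i) x).hasDerivAt
    have hd := HasDerivAt.fun_sum (u := Finset.HasAntidiagonal.antidiagonal n) fun p _ =>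
      ((hu' p.1).fun_mul (hy' p.2)).const_mul (n.choose p.1 : ℝ)
    rw [Psi1, hd.deriv, Finset.sum_antidiagonal_choose_succ_mul
      (fun i j => (Psi1 s)^[i] u x * iteratedDeriv j y x), Finset.mul_sum,
      ← Finset.sum_add_distrib, ← Finset.sum_add_distrib]
    refine Finset.sum_congr rfl fun p hp => ?_
    rw [← Nat.choose_symm_of_eq_add (Finset.HasAntidiagonal.mem_antidiagonal.mp hp).symm,
      Function.iterate_succ_apply', Psi1]
    ring

theorem psi1_one (s : ℝ → ℝ) : Psi1 s (fun _ => 1) = s := by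
  funext x
  simp [Psi1]

/-- when `r = 1`, for every `n ≥ 1` and every smooth `y`,
`Ψ^n y = y^{(n)} + ∑_{j=1}^{n} (binom(n,j) · Ψ^{j-1} s) · y^{(n-j)}`. -/
theorem psi1_iterate_eq (s : ℝ → ℝ) (hs : ContDiff ℝ (⊤ : ℕ∞) s)
    (n : ℕ) (hn : 1 ≤ n) (y : ℝ → ℝ) (hy : ContDiff ℝ (⊤ : ℕ∞) y) :
    (Psi1 s)^[n] y =
      fun x => iteratedDeriv n y x +
        ∑ j ∈ Finset.Icc 1 n,
          (n.choose j : ℝ) * (Psi1 s)^[j - 1] s x * iteratedDeriv (n - j) y x := by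
  have h := psi1_iterate_mul hs (contDiff_const (c := (1 : ℝ))) hy n
  simp only [one_mul] at h
  refine h.trans (funext fun x => ?_)
  rw [Finset.Nat.sum_antidiagonal_eq_sum_range_succ
    (fun i j => (n.choose i : ℝ) * ((Psi1 s)^[i] (fun _ => 1) x * iteratedDeriv j y x)),
    Finset.sum_range_succ', add_comm, Finset.range_eq_Ico,
    Finset.sum_Ico_add' (fun i => (n.choose i : ℝ) *
      ((Psi1 s)^[i] (fun _ => 1) x * iteratedDeriv (n - i) y x)) 0 n 1]
  congr 1
  · simp
  · refine Finset.sum_congr (by ext; simp) fun j hj => ?_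
    obtain ⟨k, rfl⟩ := Nat.exists_eq_add_of_le' (Finset.mem_Icc.mp hj).1
    rw [Function.iterate_succ_apply, psi1_one, Nat.add_sub_cancel, mul_assoc]
end

section
/- For every n ≥ 1 and every j with 1 ≤ j ≤ n, the coefficient functions satisfy K n j = ∑_{k=j}^{n} r^{k-j} · Ψ(K (n-k+j-1) (j-1)), where r^{k-j} denotes the pointwise (k-j)-th power of r. -/
/-- The first-order differential operator `Ψ y = r·y' + s·y`. -/
noncomputable def Psi (r s : ℝ → ℝ) (y : ℝ → ℝ) : ℝ → ℝ :=
  fun x => r x * deriv y x + s x * y x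


/-- The coefficient functions `K n j` of the iterative equation, defined by the
recurrence `K 0 0 = 1`, `K m j = 0` for `j > m`,
`K n j = r · K (n-1) j + Ψ (K (n-1) (j-1))` for `n ≥ 1`, `1 ≤ j ≤ n`,
and `K n 0 = r · K (n-1) 0` for `n ≥ 1`. -/
noncomputable def K (r s : ℝ → ℝ) : ℕ → ℕ → ℝ → ℝ
  | 0, 0 => fun _ => 1
  | 0, _ + 1 => fun _ => 0
  | n + 1, 0 => fun x => r x * K r s n 0 x
  | n + 1, j + 1 => fun x => r x * K r s n (j + 1) x + Psi r s (K r s n j) x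


theorem K_eq_zero_of_lt (r s : ℝ → ℝ) {m j : ℕ} (h : m < j) : K r s m j = 0 := by
  induction m generalizing j with
  | zero =>
    obtain ⟨i, rfl⟩ : ∃ i, j = i + 1 := ⟨j - 1, by omega⟩
    funext x
    simp [K]
  | succ m ih =>
    obtain ⟨i, rfl⟩ : ∃ i, j = i + 1 := ⟨j - 1, by omega⟩
    funext x
    simp [K, Psi, ih (show m < i by omega), ih (show m < i + 1 by omega)]

theorem K_add_succ_apply (r s : ℝ → ℝ) (i d : ℕ) (x : ℝ) :
    K r s (i + d + 1) (i + 1) x =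
      ∑ l ∈ Finset.range (d + 1), r x ^ l * Psi r s (K r s (i + d - l) i) x := by
  induction d with
  | zero => simp [K, K_eq_zero_of_lt r s (Nat.lt_succ_self i)]
  | succ d ih =>
    rw [Finset.sum_range_succ', K, ← Nat.add_assoc]
    beta_reduce
    rw [ih, Finset.mul_sum]
    simp only [Nat.add_sub_add_right, pow_succ', pow_zero, one_mul, Nat.sub_zero, mul_assoc]

/-- for `n ≥ 1` and `1 ≤ j ≤ n`,
`K n j = ∑_{k=j}^{n} r^{k-j} · Ψ (K (n-k+j-1) (j-1))`. -/
theorem coeff_recurrence_sum' (r s : ℝ → ℝ) (hr : ContDiff ℝ (⊤ : ℕ∞) r) (hs : ContDiff ℝ (⊤ : ℕ∞) s)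
    (n j : ℕ) (hn : 1 ≤ n) (hj : 1 ≤ j) (hjn : j ≤ n) :
    K r s n j =
      ∑ k ∈ Finset.Icc j n,
        fun x => r x ^ (k - j) * Psi r s (K r s (n - k + j - 1) (j - 1)) x := by
  obtain ⟨i, rfl⟩ : ∃ i, j = i + 1 := ⟨j - 1, by omega⟩
  obtain ⟨d, rfl⟩ : ∃ d, n = i + d + 1 := ⟨n - (i + 1), by omega⟩
  funext x
  rw [Finset.sum_apply, K_add_succ_apply, ← Finset.Ico_add_one_right_eq_Icc,
    Finset.sum_Ico_eq_sum_range, show i + d + 1 + 1 - (i + 1) = d + 1 by omega]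
  refine Finset.sum_congr rfl fun l hl => ?_
  have hl' := Finset.mem_range.mp hl
  rw [Nat.add_sub_cancel_left, Nat.add_sub_cancel,
    show i + d + 1 - (i + 1 + l) + (i + 1) - 1 = i + d - l by omega]
end

section
/- For every n ≥ 1, the coefficient function K n 1 satisfies K n 1 = r^{n-1} · (n·s + binom(n, 2)·r'), where r' is the derivative of r and r^{n-1} denotes the pointwise (n-1)-th power of r. -/
theorem K_zero_right (r s : ℝ → ℝ) (n : ℕ) : K r s n 0 = fun x => r x ^ n := by
  induction n with
  | zero => simp [K]
  | succ n ih =>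
    funext x
    simp only [K, ih, pow_succ']

/-- for `n ≥ 1`, `K n 1 = r^{n-1} · (n·s + binom(n,2)·r')`. -/
theorem coeff_K_n_one (r s : ℝ → ℝ) (hr : ContDiff ℝ (⊤ : ℕ∞) r) (hs : ContDiff ℝ (⊤ : ℕ∞) s)
    (n : ℕ) (hn : 1 ≤ n) :
    K r s n 1 =
      fun x => r x ^ (n - 1) * ((n : ℝ) * s x + (n.choose 2 : ℝ) * deriv r x) := by
  have hd : Differentiable ℝ r := hr.differentiable (by simp)
  have hderiv (m : ℕ) (x : ℝ) :
      deriv (fun y => r y ^ m) x = m * r x ^ (m - 1) * deriv r x :=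
    ((hd x).hasDerivAt.pow m).deriv
  induction n, hn using Nat.le_induction with
  | base =>
    funext x
    simp [K, Psi]
  | succ n hn ih =>
    obtain ⟨m, rfl⟩ := Nat.exists_eq_add_of_le' hn
    funext x
    rw [K, ih, K_zero_right]
    simp only [Psi, hderiv]
    rw [Nat.choose_succ_succ' (m + 1) 1, Nat.choose_one_right]
    simp only [Nat.add_sub_cancel]
    push_cast
    ring
end

section
/- For every n ≥ 2, the coefficient function K n 2 satisfies K n 2 = r^{n-2} · ( binom(n, 2)·Ψ s + binom(n, 3)·( 3·s·r' + r·r'' + ((3n−5)/4)·(r')² ) ), where Ψ s = r·s' + s², r' and r'' are the first and second derivatives of r, and r^{n-2} denotes the pointwise (n-2)-th power of r. -/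
theorem K_succ_succ_apply (r s : ℝ → ℝ) (n j : ℕ) (x : ℝ) :
    K r s (n + 1) (j + 1) x = r x * K r s n (j + 1) x + Psi r s (K r s n j) x := by
  simp only [K]

theorem K_succ_one (r s : ℝ → ℝ) (hr : Differentiable ℝ r) (n : ℕ) :
    K r s (n + 1) 1 = fun x =>
      r x ^ n * (((n : ℝ) + 1) * s x + ((n + 1).choose 2 : ℝ) * deriv r x) := by
  induction n with
  | zero => funext x; simp [K, Psi]
  | succ n ih =>
    funext x
    have hd : deriv (fun y => r y ^ (n + 1)) x = ((n : ℝ) + 1) * r x ^ n * deriv r x := by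
      simpa using ((hr x).hasDerivAt.fun_pow (n + 1)).deriv
    rw [K_succ_succ_apply, ih, K_zero_right, Psi, hd, Nat.cast_choose_two, Nat.cast_choose_two]
    push_cast
    ring

theorem cast_choose_three (n : ℕ) :
    (n.choose 3 : ℝ) = (n : ℝ) * ((n : ℝ) - 1) * ((n : ℝ) - 2) / 6 := by
  induction n with
  | zero => simp
  | succ n ih =>
    rw [Nat.choose_succ_succ' n 2, Nat.cast_add, ih, Nat.cast_choose_two]
    push_cast
    ring

theorem Psi_K_succ_one_apply (r s : ℝ → ℝ) (hr : Differentiable ℝ r)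
    (hr' : Differentiable ℝ (deriv r)) (hs : Differentiable ℝ s) (n : ℕ) (x : ℝ) :
    Psi r s (K r s (n + 1) 1) x = r x ^ n *
      (((n : ℝ) + 1) * Psi r s s x + ((n + 1).choose 2 : ℝ) *
        (3 * s x * deriv r x + r x * iteratedDeriv 2 r x + (n : ℝ) * deriv r x ^ 2)) := by
  have h := ((hr x).hasDerivAt.fun_pow n).fun_mul
    (((hs x).hasDerivAt.const_mul ((n : ℝ) + 1)).fun_add
      ((hr' x).hasDerivAt.const_mul ((n + 1).choose 2 : ℝ)))
  have h2 : iteratedDeriv 2 r x = deriv (deriv r) x := by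
    rw [iteratedDeriv_succ, iteratedDeriv_one]
  rw [K_succ_one r s hr, Psi, h.deriv, h2, Psi, Nat.cast_choose_two]
  rcases n with _ | n
  · simp
  · push_cast
    ring

/-- for `n ≥ 2`,
`K n 2 = r^{n-2}·(binom(n,2)·Ψs + binom(n,3)·(3·s·r' + r·r'' + ((3n-5)/4)·(r')²))`. -/
theorem coeff_K_n_two (r s : ℝ → ℝ) (hr : ContDiff ℝ (⊤ : ℕ∞) r) (hs : ContDiff ℝ (⊤ : ℕ∞) s)
    (n : ℕ) (hn : 2 ≤ n) :
    K r s n 2 =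
      fun x => r x ^ (n - 2) *
        ((n.choose 2 : ℝ) * Psi r s s x +
          (n.choose 3 : ℝ) *
            (3 * s x * deriv r x + r x * iteratedDeriv 2 r x +
              ((3 * (n : ℝ) - 5) / 4) * (deriv r x) ^ 2)) := by
  have hr1 : Differentiable ℝ r := hr.differentiable (by simp)
  have hs1 : Differentiable ℝ s := hs.differentiable (by simp)
  have hr2 : Differentiable ℝ (deriv r) :=
    (contDiff_infty_iff_deriv.mp hr).2.differentiable (by simp)
  induction n, hn using Nat.le_induction with
  | base =>
    funext x
    have h := Psi_K_succ_one_apply r s hr1 hr2 hs1 0 x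
    rw [K_succ_succ_apply, h]
    simp [K, Psi]
  | succ n hn ih =>
    obtain ⟨m, rfl⟩ := Nat.exists_eq_add_of_le' hn
    funext x
    have h := Psi_K_succ_one_apply r s hr1 hr2 hs1 (m + 1) x
    rw [K_succ_succ_apply, h, ih]
    simp only [Nat.cast_choose_two, cast_choose_three, Nat.add_sub_cancel,
      show m + 2 + 1 - 2 = m + 1 by omega]
    push_cast
    ring
end

section
/- For every n ≥ 2, the coefficient function K n 2 satisfies K n 2 = ∑_{k₂=2}^{n} ∑_{k₁=1}^{n−k₂+1} r^{k₂−2} · Ψ( r^{k₁−1} · Ψ( r^{n+1−(k₁+k₂)} ) ), where r^m denotes the pointwise m-th power of r. -/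
theorem contDiff_Psi {r s y : ℝ → ℝ} (hr : ContDiff ℝ (⊤ : ℕ∞) r) (hs : ContDiff ℝ (⊤ : ℕ∞) s)
    (hy : ContDiff ℝ (⊤ : ℕ∞) y) : ContDiff ℝ (⊤ : ℕ∞) (Psi r s y) :=
  (hr.mul (contDiff_infty_iff_deriv.1 hy).2).add (hs.mul hy)

theorem Psi_sum {ι : Type*} (r s : ℝ → ℝ) (t : Finset ι) (f : ι → ℝ → ℝ) (x : ℝ)
    (hf : ∀ i ∈ t, DifferentiableAt ℝ (f i) x) :
    Psi r s (fun u => ∑ i ∈ t, f i u) x = ∑ i ∈ t, Psi r s (f i) x := by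
  simp only [Psi, deriv_fun_sum hf, Finset.mul_sum, Finset.sum_add_distrib]

/-- Unrolling the recurrence for `K` in its first index. -/
theorem K_succ_right (r s : ℝ → ℝ) (n j : ℕ) (x : ℝ) :
    K r s n (j + 1) x = ∑ m ∈ Finset.range n, r x ^ m * Psi r s (K r s (n - 1 - m) j) x := by
  induction n with
  | zero => simp [K]
  | succ n ih =>
    rw [Finset.sum_range_succ', K]
    beta_reduce
    rw [ih, Finset.mul_sum]
    simp only [pow_zero, one_mul, Nat.add_sub_cancel, Nat.sub_zero]
    congr 1
    refine Finset.sum_congr rfl fun m _ => ?_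
    rw [pow_succ', mul_assoc, Nat.sub_sub, Nat.add_comm 1 m]

/-- for `n ≥ 2`,
`K n 2 = ∑_{k₂=2}^{n} ∑_{k₁=1}^{n-k₂+1} r^{k₂-2} · Ψ(r^{k₁-1} · Ψ(r^{n+1-(k₁+k₂)}))`. -/
theorem coeff_K_n_two_sum (r s : ℝ → ℝ) (hr : ContDiff ℝ (⊤ : ℕ∞) r) (hs : ContDiff ℝ (⊤ : ℕ∞) s)
    (n : ℕ) (hn : 2 ≤ n) :
    K r s n 2 =
      ∑ k₂ ∈ Finset.Icc 2 n, ∑ k₁ ∈ Finset.Icc 1 (n - k₂ + 1),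
        fun x => r x ^ (k₂ - 2) *
          Psi r s
            (fun t => r t ^ (k₁ - 1) *
              Psi r s (fun u => r u ^ (n + 1 - (k₁ + k₂))) t) x := by
  funext x
  obtain ⟨n, rfl⟩ := Nat.exists_eq_add_of_le' hn
  have hK : ∀ l, K r s l 1 = fun t => ∑ k ∈ Finset.range l,
      r t ^ k * Psi r s (fun u => r u ^ (l - 1 - k)) t := fun l => by
    funext t
    rw [K_succ_right]
    simp only [K_zero_right]
  have hd : ∀ k p : ℕ, Differentiable ℝ fun t => r t ^ k * Psi r s (fun u => r u ^ p) t :=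
    fun k p => ((hr.pow k).mul (contDiff_Psi hr hs (hr.pow p))).differentiable (by simp)
  have hIcc : ∀ a m : ℕ, Finset.Icc a (m + a) = Finset.Ico (0 + a) (m + 1 + a) := fun a m => by
    ext i; simp only [Finset.mem_Icc, Finset.mem_Ico]; omega
  have hsum : ∀ (a m : ℕ) (f : ℕ → ℝ),
      ∑ i ∈ Finset.Icc a (m + a), f i = ∑ i ∈ Finset.range (m + 1), f (i + a) := fun a m f => by
    rw [hIcc, ← Finset.sum_Ico_add', Finset.range_eq_Ico]
  simp only [Finset.sum_apply]
  rw [K_succ_right, Finset.sum_range_succ, hsum]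
  simp only [hK]
  rw [show n + 2 - 1 - (n + 1) = 0 by omega]
  simp only [Finset.range_zero, Finset.sum_empty,
    Psi_sum r s _ _ x fun i _ => (hd i _).differentiableAt]
  have h0 : Psi r s (fun _ => 0) x = 0 := by simp [Psi]
  rw [h0, mul_zero, add_zero]
  refine Finset.sum_congr rfl fun m hm => ?_
  have hm' : m ≤ n := Nat.lt_succ_iff.1 (Finset.mem_range.1 hm)
  rw [hsum, Finset.mul_sum, show n + 2 - 1 - m = n + 2 - (m + 2) + 1 by omega]
  refine Finset.sum_congr rfl fun k _ => ?_
  rw [show n + 2 - (m + 2) + 1 - 1 - k = n + 2 + 1 - (k + 1 + (m + 2)) by omega,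
    Nat.add_sub_cancel, Nat.add_sub_cancel]
end

section
/- Let n ≥ 1 and 1 ≤ j ≤ n. The number of tuples of integers (k₁, …, k_j) satisfying, for each i = 1, …, j, the inequalities i ≤ k_i ≤ n + binom(j, 2) − binom(i, 2) − ∑_{u=i+1}^{j} k_u, equals the binomial coefficient binom(n, j). -/
theorem Fin.sum_Ici_val_add_one_add_choose_two {j : ℕ} (m : Fin j) :
    ∑ u ∈ Finset.Ici m, ((u : ℕ) + 1 : ℤ) + (((m : ℕ) + 1).choose 2 : ℤ) =
      j + (j.choose 2 : ℤ) := by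
  have key : ∀ b : ℕ, (m : ℕ) ≤ b →
      ∑ u ∈ Finset.Ico (m : ℕ) b, ((u : ℤ) + 1) + (((m : ℕ) + 1).choose 2 : ℤ) =
        ((b + 1).choose 2 : ℤ) := by
    intro b hb
    induction b, hb using Nat.le_induction with
    | base => simp
    | succ b hb ih =>
      rw [Finset.sum_Ico_succ_top hb, Nat.choose_succ_succ' (b + 1) 1, Nat.choose_one_right]
      push_cast
      linarith
  have hmap : ∑ u ∈ Finset.Ici m, ((u : ℕ) + 1 : ℤ) =
      ∑ u ∈ Finset.Ico (m : ℕ) j, ((u : ℤ) + 1) := by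
    rw [← Fin.map_valEmbedding_Ici, Finset.sum_map]
    rfl
  rw [hmap, key j m.isLt.le, Nat.choose_succ_succ' j 1, Nat.choose_one_right]
  push_cast
  rfl

/-- After subtracting the minimal tuple `(1, …, j)`, the upper bounds all follow from the one
on the total sum. -/
theorem forall_le_and_le_sub_sum_Ioi_iff {n j : ℕ} (hj : 1 ≤ j) (k : Fin j → ℤ) :
    (∀ m : Fin j, ((m : ℕ) + 1 : ℤ) ≤ k m ∧
        k m ≤ (n : ℤ) + (j.choose 2 : ℤ) - ((((m : ℕ) + 1).choose 2 : ℤ)) -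
          ∑ u ∈ Finset.Ioi m, k u) ↔
      (∀ m : Fin j, ((m : ℕ) + 1 : ℤ) ≤ k m) ∧
        ∑ u : Fin j, (k u - ((u : ℕ) + 1)) ≤ (n : ℤ) - j := by
  have upper_iff : ∀ m : Fin j,
      k m ≤ (n : ℤ) + (j.choose 2 : ℤ) - ((((m : ℕ) + 1).choose 2 : ℤ)) -
          ∑ u ∈ Finset.Ioi m, k u ↔
        ∑ u ∈ Finset.Ici m, (k u - ((u : ℕ) + 1)) ≤ (n : ℤ) - j := by
    intro m
    rw [Finset.sum_sub_distrib, ← Finset.add_sum_Ioi_eq_sum_Ici (f := k)]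
    have := Fin.sum_Ici_val_add_one_add_choose_two m
    constructor <;> intro h <;> linarith
  simp only [upper_iff, forall_and]
  refine and_congr_right fun hk => ⟨fun h => ?_, fun h m => le_trans ?_ h⟩
  · have huniv : Finset.Ici (⟨0, hj⟩ : Fin j) = Finset.univ := by
      ext u
      simp [Fin.le_def]
    simpa only [huniv] using h ⟨0, hj⟩
  · exact Finset.sum_le_sum_of_subset_of_nonneg (Finset.subset_univ _)
      fun u _ _ => sub_nonneg.2 (hk u)

theorem ncard_setOf_sum_eq (ι : Type*) [Fintype ι] (d : ℕ) :
    {P : ι → ℕ | ∑ i, P i = d}.ncard = (Fintype.card ι + d - 1).choose d := by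
  classical
  rw [← Nat.card_coe_set_eq, ← Nat.card_eq_fintype_card, ← Sym.natCard_sym_eq_choose]
  exact Nat.card_congr (Sym.equivNatSumOfFintype ι d).symm

/-- for `n ≥ 1` and `1 ≤ j ≤ n`, the number of integer tuples
`(k₁, …, k_j)` (encoded as functions `k : Fin j → ℤ`, with `k_i = k ⟨i-1⟩`)
satisfying, for each `i = 1, …, j`,
`i ≤ k_i ≤ n + binom(j,2) − binom(i,2) − ∑_{u=i+1}^{j} k_u`,
equals `binom(n, j)`. -/
theorem card_tuples_eq_choose (n j : ℕ) (hn : 1 ≤ n) (hj : 1 ≤ j) (hjn : j ≤ n) :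
    Set.ncard
      {k : Fin j → ℤ | ∀ m : Fin j,
        ((m : ℕ) + 1 : ℤ) ≤ k m ∧
        k m ≤ (n : ℤ) + (j.choose 2 : ℤ) - ((((m : ℕ) + 1).choose 2 : ℤ)) -
          ∑ u ∈ Finset.Ioi m, k u} = n.choose j := by
  simp only [forall_le_and_le_sub_sum_Ioi_iff hj]
  have himage : {k : Fin j → ℤ | (∀ m : Fin j, ((m : ℕ) + 1 : ℤ) ≤ k m) ∧
      ∑ u : Fin j, (k u - ((u : ℕ) + 1)) ≤ (n : ℤ) - j} =
      Set.image (fun (P : Fin (j + 1) → ℕ) (m : Fin j) => (P m.succ : ℤ) + ((m : ℕ) + 1))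
        {P | ∑ i, P i = n - j} := by
    ext k
    simp only [Set.mem_ofPred_eq, Set.mem_image]
    constructor
    · rintro ⟨hlow, hsum⟩
      have hcast : ∀ u : Fin j, ((k u - ((u : ℕ) + 1)).toNat : ℤ) = k u - ((u : ℕ) + 1) :=
        fun u => Int.toNat_of_nonneg (sub_nonneg.2 (hlow u))
      have hle : ∑ u : Fin j, (k u - ((u : ℕ) + 1)).toNat ≤ n - j := by
        zify [hjn]
        simpa only [hcast] using hsum
      refine ⟨Fin.cons (n - j - ∑ u : Fin j, (k u - ((u : ℕ) + 1)).toNat)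
        fun u => (k u - ((u : ℕ) + 1)).toNat, ?_, ?_⟩
      · simp only [Fin.sum_univ_succ, Fin.cons_zero, Fin.cons_succ]
        exact Nat.sub_add_cancel hle
      · funext u
        simp only [Fin.cons_succ, hcast, sub_add_cancel]
    · rintro ⟨P, hP, rfl⟩
      refine ⟨fun m => by simp, ?_⟩
      rw [Fin.sum_univ_succ] at hP
      zify [hjn] at hP
      simp only [add_sub_cancel_right]
      linarith [Int.natCast_nonneg (P 0)]
  rw [himage, Set.InjOn.ncard_image, ncard_setOf_sum_eq, Fintype.card_fin,
    show j + 1 + (n - j) - 1 = n by lia, Nat.choose_symm hjn]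
  intro P hP Q hQ hPQ
  have hsucc : ∀ m : Fin j, P m.succ = Q m.succ := fun m => by
    have := congrFun hPQ m
    simpa using this
  have hzero : P 0 = Q 0 := by
    simp only [Set.mem_ofPred_eq, Fin.sum_univ_succ, hsucc] at hP hQ
    lia
  funext i
  exact Fin.cases hzero hsucc i
end

section
/- Let r : ℝ → ℝ be smooth with r(x) ≠ 0 for all x, set s = −r', and define a = ((r')² − 2·r·r'') / r². Then for every smooth function y : ℝ → ℝ, the third iterate of Ψ satisfies Ψ³ y = r³ · ( y''' + a·y' + (a'/2)·y ), where a' is the derivative of a. In other words, every third-order linear iterative equation in reduced normal form has the form y''' + a y' + (1/2) a' y = 0. -/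
theorem ContDiff.hasDerivAt_iteratedDeriv {f : ℝ → ℝ} (hf : ContDiff ℝ (⊤ : ℕ∞) f)
    (k : ℕ) (x : ℝ) :
    HasDerivAt (iteratedDeriv k f) (iteratedDeriv (k + 1) f x) x := by
  rw [iteratedDeriv_succ]
  exact (hf.differentiable_iteratedDeriv k (by exact_mod_cast ENat.natCast_lt_top k) x).hasDerivAt

theorem Psi_eq_of_hasDerivAt {r s y y' : ℝ → ℝ} (h : ∀ x, HasDerivAt y (y' x) x) :
    Psi r s y = fun x => r x * y' x + s x * y x := by
  funext x
  rw [Psi, (h x).deriv]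

/-- with `r` smooth and nonvanishing, `s = −r'`, and
`a = ((r')² − 2·r·r'')/r²`, for every smooth `y` one has
`Ψ³ y = r³·(y''' + a·y' + (a'/2)·y)`. -/
theorem third_order_normal_form (r : ℝ → ℝ) (hr : ContDiff ℝ (⊤ : ℕ∞) r) (hr0 : ∀ x, r x ≠ 0)
    (s : ℝ → ℝ) (hs : s = fun x => -deriv r x)
    (a : ℝ → ℝ)
    (ha : a = fun x => ((deriv r x) ^ 2 - 2 * r x * iteratedDeriv 2 r x) / r x ^ 2)
    (y : ℝ → ℝ) (hy : ContDiff ℝ (⊤ : ℕ∞) y) :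
    (Psi r s)^[3] y =
      fun x => r x ^ 3 *
        (iteratedDeriv 3 y x + a x * deriv y x + (deriv a x / 2) * y x) := by
  subst hs ha
  have r0 : ∀ x, HasDerivAt r (deriv r x) x := fun x => by
    simpa using hr.hasDerivAt_iteratedDeriv 0 x
  have r1 : ∀ x, HasDerivAt (deriv r) (iteratedDeriv 2 r x) x := fun x => by
    simpa using hr.hasDerivAt_iteratedDeriv 1 x
  have r2 := hr.hasDerivAt_iteratedDeriv 2
  have y0 : ∀ x, HasDerivAt y (deriv y x) x := fun x => by
    simpa using hy.hasDerivAt_iteratedDeriv 0 x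
  have y1 : ∀ x, HasDerivAt (deriv y) (iteratedDeriv 2 y x) x := fun x => by
    simpa using hy.hasDerivAt_iteratedDeriv 1 x
  have y2 := hy.hasDerivAt_iteratedDeriv 2
  have psi_one := Psi_eq_of_hasDerivAt (r := r) (s := fun x => -deriv r x) y0
  have psi_two : Psi r (fun x => -deriv r x) (Psi r (fun x => -deriv r x) y) = fun x =>
      r x ^ 2 * iteratedDeriv 2 y x - r x * deriv r x * deriv y x
        + (deriv r x ^ 2 - r x * iteratedDeriv 2 r x) * y x := by
    rw [psi_one, Psi_eq_of_hasDerivAt fun x =>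
      ((r0 x).fun_mul (y1 x)).fun_add ((r1 x).fun_neg.fun_mul (y0 x))]
    funext x
    ring
  simp only [Function.iterate_succ, Function.iterate_zero, Function.comp_apply, id_eq]
  rw [psi_two, Psi_eq_of_hasDerivAt fun x =>
    ((((r0 x).fun_pow 2).fun_mul (y2 x)).fun_sub (((r0 x).fun_mul (r1 x)).fun_mul (y1 x))).fun_add
      ((((r1 x).fun_pow 2).fun_sub ((r0 x).fun_mul (r2 x))).fun_mul (y0 x))]
  funext x
  have ha : HasDerivAt (fun x => (deriv r x ^ 2 - 2 * r x * iteratedDeriv 2 r x) / r x ^ 2) _ x :=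
    (((r1 x).fun_pow 2).fun_sub (((r0 x).const_mul 2).fun_mul (r2 x))).fun_div ((r0 x).fun_pow 2)
      (pow_ne_zero 2 (hr0 x))
  rw [ha.deriv]
  have := hr0 x
  field_simp
  ring
end

section
/- Let c₀, c₁, c₂ : ℝ → ℝ be smooth. If the third-order equation y''' + c₂ y'' + c₁ y' + c₀ y = 0 is iterative, i.e. there exist a smooth nonvanishing function r : ℝ → ℝ and a smooth function s : ℝ → ℝ such that for every smooth y : ℝ → ℝ one has Ψ³ y = r³ · ( y''' + c₂ y'' + c₁ y' + c₀ y ), then the coefficients satisfy the identity 54 c₀ − 18 c₁ c₂ + 4 c₂³ − 27 c₁' + 18 c₂ c₂' + 9 c₂'' = 0 on ℝ. -/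
lemma ContDiff.smooth_deriv {f : ℝ → ℝ} (hf : ContDiff ℝ (⊤ : ℕ∞) f) :
    ContDiff ℝ (⊤ : ℕ∞) (deriv f) :=
  (contDiff_infty_iff_deriv.1 hf).2

lemma ContDiff.smooth_hasDerivAt {f : ℝ → ℝ} (hf : ContDiff ℝ (⊤ : ℕ∞) f) (x : ℝ) :
    HasDerivAt f (deriv f x) x :=
  ((contDiff_infty_iff_deriv.1 hf).1 x).hasDerivAt

lemma Psi_iterate_three {r s y : ℝ → ℝ} (hr : ContDiff ℝ (⊤ : ℕ∞) r)
    (hs : ContDiff ℝ (⊤ : ℕ∞) s) (hy : ContDiff ℝ (⊤ : ℕ∞) y) (x : ℝ) :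
    (Psi r s)^[3] y x =
      r x ^ 3 * deriv (deriv (deriv y)) x
      + 3 * r x ^ 2 * (deriv r x + s x) * deriv (deriv y) x
      + r x * (deriv r x ^ 2 + r x * deriv (deriv r) x + 3 * deriv r x * s x
        + 3 * r x * deriv s x + 3 * s x ^ 2) * deriv y x
      + (r x * (deriv r x * deriv s x + r x * deriv (deriv s) x + 3 * s x * deriv s x)
        + s x ^ 3) * y x := by
  have hr0 := hr.smooth_hasDerivAt
  have hr1 := hr.smooth_deriv.smooth_hasDerivAt
  have hs0 := hs.smooth_hasDerivAt
  have hs1 := hs.smooth_deriv.smooth_hasDerivAt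
  have hy0 := hy.smooth_hasDerivAt
  have hy1 := hy.smooth_deriv.smooth_hasDerivAt
  have hy2 := hy.smooth_deriv.smooth_deriv.smooth_hasDerivAt
  have e2 : Psi r s (Psi r s y) = fun x => r x * (r x * deriv (deriv y) x)
      + (r x * (deriv r x + 2 * s x)) * deriv y x + (r x * deriv s x + s x * s x) * y x := by
    funext x
    have h : HasDerivAt (Psi r s y) _ x := ((hr0 x).mul (hy1 x)).add ((hs0 x).mul (hy0 x))
    rw [Psi, h.deriv, Psi]
    ring
  have h := (((hr0 x).mul ((hr0 x).mul (hy2 x))).add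
    (((hr0 x).mul ((hr1 x).add ((hs0 x).const_mul 2))).mul (hy1 x))).add
    ((((hr0 x).mul (hs1 x)).add ((hs0 x).mul (hs0 x))).mul (hy0 x))
  have h' := h.congr_of_eventuallyEq (Filter.Eventually.of_forall (congrFun e2))
  change Psi r s (Psi r s (Psi r s y)) x = _
  rw [Psi, h'.deriv, e2]
  simp only [Pi.mul_apply, Pi.add_apply]
  ring

/-- if the third-order equation `y''' + c₂ y'' + c₁ y' + c₀ y = 0`
is iterative, then `54 c₀ − 18 c₁ c₂ + 4 c₂³ − 27 c₁' + 18 c₂ c₂' + 9 c₂'' = 0`. -/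
theorem third_order_iterative_coeff_identity
    (c₀ c₁ c₂ : ℝ → ℝ)
    (h0 : ContDiff ℝ (⊤ : ℕ∞) c₀) (h1 : ContDiff ℝ (⊤ : ℕ∞) c₁) (h2 : ContDiff ℝ (⊤ : ℕ∞) c₂)
    (hiter : ∃ r s : ℝ → ℝ, ContDiff ℝ (⊤ : ℕ∞) r ∧ ContDiff ℝ (⊤ : ℕ∞) s ∧ (∀ x, r x ≠ 0) ∧
      ∀ y : ℝ → ℝ, ContDiff ℝ (⊤ : ℕ∞) y →
        (Psi r s)^[3] y =
          fun x => r x ^ 3 *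
            (iteratedDeriv 3 y x + c₂ x * iteratedDeriv 2 y x + c₁ x * deriv y x +
              c₀ x * y x)) :
    ∀ x, 54 * c₀ x - 18 * c₁ x * c₂ x + 4 * c₂ x ^ 3 - 27 * deriv c₁ x +
      18 * c₂ x * deriv c₂ x + 9 * iteratedDeriv 2 c₂ x = 0 := by
  obtain ⟨r, s, hr, hs, hne, hiter⟩ := hiter
  have key : ∀ y : ℝ → ℝ, ContDiff ℝ (⊤ : ℕ∞) y → ∀ x, _ := fun y hy x =>
    (Psi_iterate_three hr hs hy x).symm.trans (congrFun (hiter y hy) x)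
  simp only [iteratedDeriv_succ, iteratedDeriv_zero] at key ⊢
  have e0 : ∀ x, r x ^ 3 * c₀ x = r x * (deriv r x * deriv s x + r x * deriv (deriv s) x
      + 3 * s x * deriv s x) + s x ^ 3 := fun x => by
    have := key (fun _ => 1) contDiff_const x
    simp at this
    linarith
  have e1 : ∀ x, r x * r x * c₁ x = deriv r x * deriv r x + r x * deriv (deriv r) x
      + 3 * (deriv r x * s x) + 3 * (r x * deriv s x) + 3 * (s x * s x) := fun x => by
    have hd : deriv (fun t : ℝ => t - x) = fun _ => 1 := by funext t; simp
    have := key (fun t => t - x) (contDiff_id.sub contDiff_const) x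
    simp [hd] at this
    apply mul_left_cancel₀ (hne x)
    linarith
  have e2 : ∀ x, r x * c₂ x = 3 * (deriv r x + s x) := fun x => by
    have hd : deriv (fun t : ℝ => (t - x) ^ 2) = fun t => 2 * (t - x) := by
      funext t
      simp
    have hd' : deriv (fun t : ℝ => 2 * (t - x)) = fun _ => 2 := by
      funext t
      simp
    have := key (fun t => (t - x) ^ 2) ((contDiff_id.sub contDiff_const).pow 2) x
    simp [hd, hd'] at this
    apply mul_left_cancel₀ (pow_ne_zero 2 (hne x))
    linarith
  have hr0 := hr.smooth_hasDerivAt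
  have hr1 := hr.smooth_deriv.smooth_hasDerivAt
  have hr2 := hr.smooth_deriv.smooth_deriv.smooth_hasDerivAt
  have hs0 := hs.smooth_hasDerivAt
  have hs1 := hs.smooth_deriv.smooth_hasDerivAt
  have hc1 := h1.smooth_hasDerivAt
  have hc2 := h2.smooth_hasDerivAt
  have hc2' := h2.smooth_deriv.smooth_hasDerivAt
  have d1 := fun x => (((hr0 x).mul (hr0 x)).mul (hc1 x)).unique
    ((((((hr1 x).mul (hr1 x)).add ((hr0 x).mul (hr2 x))).add
      (((hr1 x).mul (hs0 x)).const_mul 3)).add (((hr0 x).mul (hs1 x)).const_mul 3)).add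
      (((hs0 x).mul (hs0 x)).const_mul 3) |>.congr_of_eventuallyEq
        (Filter.Eventually.of_forall e1))
  have d2 := fun x => ((hr0 x).mul (hc2 x)).unique
    ((((hr1 x).add (hs0 x)).const_mul 3).congr_of_eventuallyEq (Filter.Eventually.of_forall e2))
  have d3 := fun x => (((hr1 x).mul (hc2 x)).add ((hr0 x).mul (hc2' x))).unique
    ((((hr2 x).add (hs1 x)).const_mul 3).congr_of_eventuallyEq (Filter.Eventually.of_forall d2))
  intro x
  have hx := hne x
  have E0 := e0 x
  have E1 := e1 x
  have E2 := e2 x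
  have D1 := d1 x
  have D2 := d2 x
  have D3 := d3 x
  simp only [Pi.mul_apply] at D1 D2 D3
  generalize r x = R, s x = S, c₀ x = C0, c₁ x = C1, c₂ x = C2, deriv r x = R1,
    deriv s x = S1, deriv (deriv r) x = R2, deriv (deriv s) x = S2,
    deriv (deriv (deriv r)) x = R3, deriv c₁ x = C1', deriv c₂ x = C2',
    deriv (deriv c₂) x = C2'' at *
  obtain rfl : S = R * C2 / 3 - R1 := by linarith
  obtain rfl : S1 = (R1 * C2 + R * C2') / 3 - R2 := by linarith
  obtain rfl : S2 = (R1 * C2' + R1 * C2' + R2 * C2 + R * C2'') / 3 - R3 := by linarith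
  apply mul_left_cancel₀ (pow_ne_zero 3 hx)
  linear_combination 54 * E0 - 18 * C2 * R * E1 - 27 * R * D1 + 54 * R1 * E1
end

section
/- Let a : ℝ → ℝ be smooth and let x₀ ∈ ℝ. Then there exist an open interval I containing x₀ and a smooth nonvanishing function r : I → ℝ such that, with s = −r' and Ψ the operator (Ψ y)(x) = r(x) y'(x) + s(x) y(x) on smooth functions on I, one has for every smooth y : I → ℝ the identity Ψ³ y = r³ · ( y''' + a y' + (a'/2) y ) on I. That is, every equation of the form y''' + a y' + (1/2) a' y = 0 is locally iterative. -/
open Set Filter Topology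

/-- An integral curve of a smooth autonomous vector field is smooth. -/
theorem contDiffOn_of_hasDerivAt_autonomous {E : Type*} [NormedAddCommGroup E] [NormedSpace ℝ E]
    {f : E → E} (hf : ContDiff ℝ (⊤ : ℕ∞) f) {α : ℝ → E} {s : Set ℝ} (hs : IsOpen s)
    (hα : ∀ t ∈ s, HasDerivAt α (f (α t)) t) : ContDiffOn ℝ (⊤ : ℕ∞) α s := by
  rw [contDiffOn_infty]
  intro n
  induction n with
  | zero =>
    simpa using HasDerivAt.continuousOn hα
  | succ n ih =>
    push_cast
    rw [contDiffOn_succ_iff_deriv_of_isOpen hs]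
    refine ⟨fun t ht => (hα t ht).differentiableAt.differentiableWithinAt, by simp, ?_⟩
    exact ((hf.of_le (by exact_mod_cast le_top)).comp_contDiffOn ih).congr
      fun t ht => (hα t ht).deriv

/-- Local existence of a smooth nonvanishing solution of `v'' = -(a / 4) v`, written as the
first-order system `v' = w`, `w' = -(a / 4) v`. -/
theorem exists_local_nonvanishing_solution {a : ℝ → ℝ} (ha : ContDiff ℝ (⊤ : ℕ∞) a) (x₀ : ℝ) :
    ∃ l u : ℝ, l < x₀ ∧ x₀ < u ∧ ∃ v w : ℝ → ℝ, ContDiffOn ℝ (⊤ : ℕ∞) v (Ioo l u) ∧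
      (∀ x ∈ Ioo l u, v x ≠ 0) ∧
      (∀ x ∈ Ioo l u, HasDerivAt v (w x) x) ∧
      ∀ x ∈ Ioo l u, HasDerivAt w (-(a x / 4) * v x) x := by
  let f : ℝ × ℝ × ℝ → ℝ × ℝ × ℝ := fun p => (1, p.2.2, -(a p.1 / 4) * p.2.1)
  have hf : ContDiff ℝ (⊤ : ℕ∞) f := by
    have : ContDiff ℝ (⊤ : ℕ∞) (fun p : ℝ × ℝ × ℝ => a p.1) := ha.comp contDiff_fst
    fun_prop
  obtain ⟨α, hα₀, ε, hε, hα⟩ :=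
    (hf.of_le (by exact_mod_cast le_top) : ContDiff ℝ 1 f).contDiffAt
      (x := (x₀, 1, 0)) |>.exists_forall_mem_closedBall_exists_eq_forall_mem_Ioo_hasDerivAt₀ x₀
  have hx₀ : x₀ ∈ Ioo (x₀ - ε) (x₀ + ε) := ⟨by linarith, by linarith⟩
  have hα₁ : ∀ t ∈ Ioo (x₀ - ε) (x₀ + ε), HasDerivAt (fun t => (α t).1) 1 t :=
    fun t ht => (ContinuousLinearMap.fst ℝ ℝ (ℝ × ℝ)).hasFDerivAt.comp_hasDerivAt t (hα t ht)
  have hα₂ : ∀ t ∈ Ioo (x₀ - ε) (x₀ + ε), HasDerivAt (fun t => (α t).2) (f (α t)).2 t :=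
    fun t ht => (ContinuousLinearMap.snd ℝ ℝ (ℝ × ℝ)).hasFDerivAt.comp_hasDerivAt t (hα t ht)
  have hv : ∀ t ∈ Ioo (x₀ - ε) (x₀ + ε), HasDerivAt (fun t => (α t).2.1) (α t).2.2 t :=
    fun t ht => (ContinuousLinearMap.fst ℝ ℝ ℝ).hasFDerivAt.comp_hasDerivAt t (hα₂ t ht)
  have hw : ∀ t ∈ Ioo (x₀ - ε) (x₀ + ε),
      HasDerivAt (fun t => (α t).2.2) (-(a (α t).1 / 4) * (α t).2.1) t :=
    fun t ht => (ContinuousLinearMap.snd ℝ ℝ ℝ).hasFDerivAt.comp_hasDerivAt t (hα₂ t ht)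
  have htime : EqOn (fun t => (α t).1) id (Ioo (x₀ - ε) (x₀ + ε)) := by
    refine isOpen_Ioo.eqOn_of_deriv_eq isPreconnected_Ioo
      (fun t ht => (hα₁ t ht).differentiableAt.differentiableWithinAt)
      differentiableOn_id (fun t ht => ?_) hx₀ (by simp [hα₀])
    rw [(hα₁ t ht).deriv, deriv_id]
  have hsmooth := contDiffOn_of_hasDerivAt_autonomous hf isOpen_Ioo hα
  have hne : ∀ᶠ x in 𝓝 x₀, (α x).2.1 ≠ 0 :=
    (hv x₀ hx₀).continuousAt.eventually_ne (by simp [hα₀])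
  obtain ⟨l, u, hmem, hsub⟩ := mem_nhds_iff_exists_Ioo_subset.1
    (inter_mem (Ioo_mem_nhds hx₀.1 hx₀.2) hne)
  refine ⟨l, u, hmem.1, hmem.2, fun x => (α x).2.1, fun x => (α x).2.2,
    (hsmooth.mono fun x hx => (hsub hx).1).snd.fst, fun x hx => (hsub hx).2,
    fun x hx => hv x (hsub hx).1, fun x hx => ?_⟩
  have ht : (α x).1 = x := htime (hsub hx).1
  simpa only [ht] using hw x (hsub hx).1

/-- If `2 r r'' - r'² + a r² = 0`, then the threefold iterate of `y ↦ r y' - r' y` is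
`r³ (y''' + a y' + (a' / 2) y)`. -/
theorem Psi_iterate_three_s16 {s : Set ℝ} (hs : IsOpen s)
    {r r₁ r₂ r₃ y y₁ y₂ y₃ a a₁ : ℝ → ℝ}
    (hr : ∀ x ∈ s, HasDerivAt r (r₁ x) x) (hr₁ : ∀ x ∈ s, HasDerivAt r₁ (r₂ x) x)
    (hr₂ : ∀ x ∈ s, HasDerivAt r₂ (r₃ x) x)
    (hy : ∀ x ∈ s, HasDerivAt y (y₁ x) x) (hy₁ : ∀ x ∈ s, HasDerivAt y₁ (y₂ x) x)
    (hy₂ : ∀ x ∈ s, HasDerivAt y₂ (y₃ x) x)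
    (h₂ : ∀ x ∈ s, 2 * r x * r₂ x - r₁ x ^ 2 + a x * r x ^ 2 = 0)
    (h₃ : ∀ x ∈ s, r₃ x = -a x * r₁ x - a₁ x / 2 * r x)
    {x : ℝ} (hx : x ∈ s) :
    (Psi r (fun t => -deriv r t))^[3] y x =
      r x ^ 3 * (y₃ x + a x * y₁ x + (a₁ x / 2) * y x) := by
  have step : ∀ {z z' : ℝ → ℝ}, ∀ t ∈ s, HasDerivAt z (z' t) t →
      Psi r (fun t => -deriv r t) z t = r t * z' t - r₁ t * z t := by
    intro z z' t ht hz
    simp only [Psi, hz.deriv, (hr t ht).deriv]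
    ring
  have e₁ : EqOn (Psi r (fun t => -deriv r t) y) (fun t => r t * y₁ t - r₁ t * y t) s :=
    fun t ht => step t ht (hy t ht)
  have d₁ : ∀ t ∈ s, HasDerivAt (Psi r (fun t => -deriv r t) y) (r t * y₂ t - r₂ t * y t) t := by
    intro t ht
    refine HasDerivAt.congr_of_eventuallyEq ?_ (e₁.eventuallyEq_of_mem (hs.mem_nhds ht))
    exact (((hr t ht).mul (hy₁ t ht)).sub ((hr₁ t ht).mul (hy t ht))).congr_deriv (by ring)
  have e₂ : EqOn (Psi r (fun t => -deriv r t) (Psi r (fun t => -deriv r t) y))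
      (fun t => r t * (r t * y₂ t - r₂ t * y t) - r₁ t * (r t * y₁ t - r₁ t * y t)) s := by
    intro t ht
    rw [step (z' := fun t => r t * y₂ t - r₂ t * y t) t ht (d₁ t ht), e₁ ht]
  have d₂ := HasDerivAt.congr_of_eventuallyEq
    (((hr x hx).mul (((hr x hx).mul (hy₂ x hx)).sub ((hr₂ x hx).mul (hy x hx)))).sub
      ((hr₁ x hx).mul (((hr x hx).mul (hy₁ x hx)).sub ((hr₁ x hx).mul (hy x hx)))))
    (e₂.eventuallyEq_of_mem (hs.mem_nhds hx))
  simp only [Function.iterate_succ, Function.iterate_zero, Function.comp_apply, id_eq]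
  rw [step (z' := fun _ => _) x hx d₂, e₂ hx]
  simp only [Pi.mul_apply, Pi.sub_apply, h₃ x hx]
  linear_combination (r₁ x * y x - r x * y₁ x) * h₂ x hx

/-- every equation of the form `y''' + a y' + (1/2) a' y = 0` is
locally iterative: about every point `x₀` there is an open interval `Ioo l u`
and a smooth nonvanishing `r` on it such that, with `s = −r'`, for every smooth
`y` on the interval one has `Ψ³ y = r³·(y''' + a y' + (a'/2) y)` there. -/
theorem third_order_locally_iterative (a : ℝ → ℝ) (ha : ContDiff ℝ (⊤ : ℕ∞) a) (x₀ : ℝ) :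
    ∃ l u : ℝ, l < x₀ ∧ x₀ < u ∧
      ∃ r : ℝ → ℝ, ContDiffOn ℝ (⊤ : ℕ∞) r (Set.Ioo l u) ∧
        (∀ x ∈ Set.Ioo l u, r x ≠ 0) ∧
        ∀ y : ℝ → ℝ, ContDiffOn ℝ (⊤ : ℕ∞) y (Set.Ioo l u) →
          ∀ x ∈ Set.Ioo l u,
            (Psi r (fun t => -deriv r t))^[3] y x =
              r x ^ 3 *
                (iteratedDeriv 3 y x + a x * deriv y x + (deriv a x / 2) * y x) := by
  obtain ⟨l, u, hl, hu, v, w, hv, hv₀, hdv, hdw⟩ := exists_local_nonvanishing_solution ha x₀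
  refine ⟨l, u, hl, hu, fun x => v x ^ 2, hv.pow 2, fun x hx => pow_ne_zero 2 (hv₀ x hx), ?_⟩
  intro y hy x hx
  have hda : ∀ x, HasDerivAt a (deriv a x) x :=
    fun x => (ha.differentiable (by simp) x).hasDerivAt
  have hD : ∀ {g : ℝ → ℝ}, ContDiffOn ℝ (⊤ : ℕ∞) g (Ioo l u) →
      (∀ x ∈ Ioo l u, HasDerivAt g (deriv g x) x) ∧ ContDiffOn ℝ (⊤ : ℕ∞) (deriv g) (Ioo l u) := by
    intro g hg
    obtain ⟨h, h'⟩ := (contDiffOn_infty_iff_deriv_of_isOpen isOpen_Ioo).1 hg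
    exact ⟨fun x hx => (h.differentiableAt (isOpen_Ioo.mem_nhds hx)).hasDerivAt, h'⟩
  obtain ⟨hy₁, hy'⟩ := hD hy
  obtain ⟨hy₂, hy''⟩ := hD hy'
  rw [show iteratedDeriv 3 y x = deriv (deriv (deriv y)) x by
    simp [iteratedDeriv_succ, iteratedDeriv_zero]]
  refine Psi_iterate_three_s16 isOpen_Ioo (r := fun x => v x ^ 2) (r₁ := fun x => 2 * v x * w x)
    (r₂ := fun x => 2 * w x ^ 2 - a x * v x ^ 2 / 2)
    (r₃ := fun x => -2 * a x * v x * w x - deriv a x / 2 * v x ^ 2) (a₁ := deriv a)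
    (fun x hx => ?_) (fun x hx => ?_) (fun x hx => ?_) hy₁ hy₂ (hD hy'').1
    (fun x _ => by ring) (fun x _ => by ring) hx
  · exact ((hdv x hx).pow 2).congr_deriv (by ring)
  · exact (((hdv x hx).const_mul 2).mul (hdw x hx)).congr_deriv (by ring)
  · exact ((((hdw x hx).pow 2).const_mul 2).sub
      (((hda x).mul ((hdv x hx).pow 2)).div_const 2)).congr_deriv (by simp; ring)
end

section
/- Let c₀, c₁, c₂, c₃ : ℝ → ℝ be smooth. The fourth-order linear equation y'''' + c₃ y''' + c₂ y'' + c₁ y' + c₀ y = 0 is iterative — meaning that about every point of ℝ there exist an open interval I, a smooth nonvanishing function r : I → ℝ, and a smooth function s : I → ℝ such that for every smooth y : I → ℝ one has Ψ⁴ y = r⁴ · ( y'''' + c₃ y''' + c₂ y'' + c₁ y' + c₀ y ) on I — if and only if the coefficients satisfy on ℝ the two identities: (i) 4 c₂ c₃ − c₃³ + 8 c₂' − 6 c₃ c₃' − 4 c₃'' − 8 c₁ = 0, and (ii) 1600 c₀ − 144 c₂² + 11 c₃⁴ − 400 c₃ c₂' + 288 c₃² c₃' + 336 (c₃')² + 8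 c₂ (c₃² + 4 c₃') − 480 c₂'' + 560 c₃ c₃'' + 320 c₃''' = 0. -/
theorem ContDiffOn.hasDerivAt_iteratedDeriv {f : ℝ → ℝ} {I : Set ℝ} (hI : IsOpen I)
    (hf : ContDiffOn ℝ (⊤ : ℕ∞) f I) (n : ℕ) :
    ∀ x ∈ I, HasDerivAt (iteratedDeriv n f) (iteratedDeriv (n + 1) f x) x := by
  have h : ∀ n : ℕ, ContDiffOn ℝ (⊤ : ℕ∞) (iteratedDeriv n f) I := by
    intro n
    induction n with
    | zero => simpa using hf
    | succ n ih =>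
      rw [iteratedDeriv_succ]
      exact ((contDiffOn_infty_iff_deriv_of_isOpen hI).1 ih).2
  intro x hx
  rw [iteratedDeriv_succ]
  exact (((h n).differentiableOn (by simp)).differentiableAt (hI.mem_nhds hx)).hasDerivAt

theorem deriv_eqOn_of_eqOn {f g g' : ℝ → ℝ} {I : Set ℝ} (hI : IsOpen I)
    (hfg : ∀ x ∈ I, f x = g x) (hg : ∀ x ∈ I, HasDerivAt g (g' x) x) :
    ∀ x ∈ I, deriv f x = g' x := fun x hx =>
  ((hg x hx).congr_of_eventuallyEq (Filter.eventually_of_mem (hI.mem_nhds hx) hfg)).deriv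

/-- A solution of a smooth autonomous differential equation on an open set is smooth. -/
theorem contDiffOn_of_hasDerivAt_comp {E : Type*} [NormedAddCommGroup E] [NormedSpace ℝ E]
    {v : E → E} {α : ℝ → E} {I : Set ℝ} (hI : IsOpen I) (hv : ContDiff ℝ (⊤ : ℕ∞) v)
    (hα : ∀ t ∈ I, HasDerivAt α (v (α t)) t) : ContDiffOn ℝ (⊤ : ℕ∞) α I := by
  have hd : DifferentiableOn ℝ α I := fun t ht =>
    (hα t ht).differentiableAt.differentiableWithinAt
  rw [contDiffOn_infty]
  intro n
  induction n with
  | zero => simpa using hd.continuousOn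
  | succ n ih =>
    rw [Nat.cast_succ, contDiffOn_succ_iff_deriv_of_isOpen hI]
    refine ⟨hd, by simp, ?_⟩
    have hvn : ContDiff ℝ n v := hv.of_le (by exact_mod_cast le_top)
    exact (hvn.comp_contDiffOn ih).congr fun t ht => (hα t ht).deriv

theorem Psi_eq_pow_mul {r s ρ σ G F F' : ℝ → ℝ} {I : Set ℝ} (hI : IsOpen I) (k : ℕ)
    (hr : ∀ x ∈ I, HasDerivAt r (ρ x * r x) x) (hs : ∀ x ∈ I, s x = r x * σ x)
    (hG : ∀ x ∈ I, G x = r x ^ k * F x) (hF : ∀ x ∈ I, HasDerivAt F (F' x) x) :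
    ∀ x ∈ I, Psi r s G x = r x ^ (k + 1) * (F' x + (σ x + k * ρ x) * F x) := by
  intro x hx
  have h := deriv_eqOn_of_eqOn hI hG (fun x hx => ((hr x hx).pow k).mul (hF x hx)) x hx
  simp only [Psi, h, hs x hx, hG x hx]
  rcases k with _ | k
  · simp; ring
  · simp only [Nat.add_sub_cancel, Pi.pow_apply]
    push_cast
    ring

/-- The coefficient of `D² y` in `r⁻⁴ Ψ⁴ y`, where `ρ = D r / r` and `σ = s / r`. -/
noncomputable def iterCoeff₂ (ρ σ : ℝ → ℝ) (x : ℝ) : ℝ :=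
  6 * iteratedDeriv 1 σ x + 6 * σ x ^ 2 + 4 * iteratedDeriv 1 ρ x + 18 * ρ x * σ x +
    11 * ρ x ^ 2

/-- The coefficient of `D y` in `r⁻⁴ Ψ⁴ y`, where `ρ = D r / r` and `σ = s / r`. -/
noncomputable def iterCoeff₁ (ρ σ : ℝ → ℝ) (x : ℝ) : ℝ :=
  4 * iteratedDeriv 2 σ x + 12 * σ x * iteratedDeriv 1 σ x + iteratedDeriv 2 ρ x +
    8 * iteratedDeriv 1 ρ x * σ x + 18 * ρ x * iteratedDeriv 1 σ x + 4 * σ x ^ 3 +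
    18 * ρ x * σ x ^ 2 + 7 * ρ x * iteratedDeriv 1 ρ x + 22 * ρ x ^ 2 * σ x + 6 * ρ x ^ 3

/-- The coefficient of `y` in `r⁻⁴ Ψ⁴ y`, where `ρ = D r / r` and `σ = s / r`. -/
noncomputable def iterCoeff₀ (ρ σ : ℝ → ℝ) (x : ℝ) : ℝ :=
  iteratedDeriv 3 σ x + 3 * iteratedDeriv 1 σ x ^ 2 + 4 * σ x * iteratedDeriv 2 σ x +
    iteratedDeriv 2 ρ x * σ x + 4 * iteratedDeriv 1 ρ x * iteratedDeriv 1 σ x +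
    6 * ρ x * iteratedDeriv 2 σ x + 6 * σ x ^ 2 * iteratedDeriv 1 σ x +
    4 * iteratedDeriv 1 ρ x * σ x ^ 2 + 18 * ρ x * σ x * iteratedDeriv 1 σ x +
    7 * ρ x * iteratedDeriv 1 ρ x * σ x + 11 * ρ x ^ 2 * iteratedDeriv 1 σ x + σ x ^ 4 +
    6 * ρ x * σ x ^ 3 + 11 * ρ x ^ 2 * σ x ^ 2 + 6 * ρ x ^ 3 * σ x

theorem Psi_iterate_four {r s ρ σ y : ℝ → ℝ} {I : Set ℝ} (hI : IsOpen I)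
    (hr : ∀ x ∈ I, HasDerivAt r (ρ x * r x) x) (hs : ∀ x ∈ I, s x = r x * σ x)
    (hρ : ContDiffOn ℝ (⊤ : ℕ∞) ρ I) (hσ : ContDiffOn ℝ (⊤ : ℕ∞) σ I)
    (hy : ContDiffOn ℝ (⊤ : ℕ∞) y I) :
    ∀ x ∈ I, (Psi r s)^[4] y x =
      r x ^ 4 * (iteratedDeriv 4 y x + (4 * σ x + 6 * ρ x) * iteratedDeriv 3 y x +
        iterCoeff₂ ρ σ x * iteratedDeriv 2 y x + iterCoeff₁ ρ σ x * deriv y x +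
        iterCoeff₀ ρ σ x * y x) := by
  have dρ := hρ.hasDerivAt_iteratedDeriv hI
  have dσ := hσ.hasDerivAt_iteratedDeriv hI
  have dy := hy.hasDerivAt_iteratedDeriv hI
  have e₁ := Psi_eq_pow_mul (G := y) (F := iteratedDeriv 0 y) hI 0 hr hs
    (fun x _ => by simp) (dy 0)
  have e₂ := Psi_eq_pow_mul (G := Psi r s y)
      (F := fun x => iteratedDeriv 1 y x +
      (iteratedDeriv 0 σ x) * iteratedDeriv 0 y x) hI 1 hr hs
    (fun x hx => by rw [e₁ x hx]; simp)
    (fun x hx => (dy 1 x hx).add ((dσ 0 x hx).mul (dy 0 x hx)))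
  have e₃ := Psi_eq_pow_mul (G := Psi r s (Psi r s y))
      (F := fun x => iteratedDeriv 2 y x +
      (2 * iteratedDeriv 0 σ x + iteratedDeriv 0 ρ x) * iteratedDeriv 1 y x +
      (iteratedDeriv 1 σ x + iteratedDeriv 0 σ x ^ 2 +
        iteratedDeriv 0 ρ x * iteratedDeriv 0 σ x) * iteratedDeriv 0 y x) hI 2 hr hs
    (fun x hx => by rw [e₂ x hx]; simp [-mul_eq_mul_left_iff]; ring)
    (fun x hx => ((dy 2 x hx).add ((((dσ 0 x hx).const_mul 2).add (dρ 0 x hx)).mul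
      (dy 1 x hx))).add ((((dσ 1 x hx).add ((dσ 0 x hx).pow 2)).add
        ((dρ 0 x hx).mul (dσ 0 x hx))).mul (dy 0 x hx)))
  have e₄ := Psi_eq_pow_mul (G := Psi r s (Psi r s (Psi r s y)))
      (F := fun x => iteratedDeriv 3 y x +
      (3 * iteratedDeriv 0 σ x + 3 * iteratedDeriv 0 ρ x) * iteratedDeriv 2 y x +
      (3 * iteratedDeriv 1 σ x + iteratedDeriv 1 ρ x + 3 * iteratedDeriv 0 σ x ^ 2 +
        6 * (iteratedDeriv 0 ρ x * iteratedDeriv 0 σ x) +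
        2 * iteratedDeriv 0 ρ x ^ 2) * iteratedDeriv 1 y x +
      (iteratedDeriv 2 σ x + 3 * (iteratedDeriv 0 σ x * iteratedDeriv 1 σ x) +
        iteratedDeriv 1 ρ x * iteratedDeriv 0 σ x +
        3 * (iteratedDeriv 0 ρ x * iteratedDeriv 1 σ x) + iteratedDeriv 0 σ x ^ 3 +
        3 * (iteratedDeriv 0 ρ x * iteratedDeriv 0 σ x ^ 2) +
        2 * (iteratedDeriv 0 ρ x ^ 2 * iteratedDeriv 0 σ x)) * iteratedDeriv 0 y x) hI 3 hr hs
    (fun x hx => by rw [e₃ x hx]; simp [-mul_eq_mul_left_iff]; ring)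
    (fun x hx => (((dy 3 x hx).add ((((dσ 0 x hx).const_mul 3).add
        ((dρ 0 x hx).const_mul 3)).mul (dy 2 x hx))).add
      ((((((dσ 1 x hx).const_mul 3).add (dρ 1 x hx)).add
        (((dσ 0 x hx).pow 2).const_mul 3)).add
        (((dρ 0 x hx).mul (dσ 0 x hx)).const_mul 6)).add
        (((dρ 0 x hx).pow 2).const_mul 2) |>.mul (dy 1 x hx))).add
      (((((((dσ 2 x hx).add (((dσ 0 x hx).mul (dσ 1 x hx)).const_mul 3)).add
        ((dρ 1 x hx).mul (dσ 0 x hx))).add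
        (((dρ 0 x hx).mul (dσ 1 x hx)).const_mul 3)).add ((dσ 0 x hx).pow 3)).add
        (((dρ 0 x hx).mul ((dσ 0 x hx).pow 2)).const_mul 3)).add
        ((((dρ 0 x hx).pow 2).mul (dσ 0 x hx)).const_mul 2) |>.mul (dy 0 x hx)))
  intro x hx
  change Psi r s (Psi r s (Psi r s (Psi r s y))) x = _
  rw [e₄ x hx]
  simp [iterCoeff₂, iterCoeff₁, iterCoeff₀, -mul_eq_mul_left_iff]
  ring

/-- Once the two leading coefficients are those of an iterated operator, the two identities
amount to the two lowest coefficients being those of the same operator. -/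
theorem identities_iff_eq_iterCoeff {c₀ c₁ c₂ c₃ ρ σ : ℝ → ℝ} {I : Set ℝ} (hI : IsOpen I)
    (hρ : ContDiffOn ℝ (⊤ : ℕ∞) ρ I) (hσ : ContDiffOn ℝ (⊤ : ℕ∞) σ I)
    (h₃ : ∀ x ∈ I, c₃ x = 4 * σ x + 6 * ρ x) (h₂ : ∀ x ∈ I, c₂ x = iterCoeff₂ ρ σ x) :
    ∀ x ∈ I, (4 * c₂ x * c₃ x - c₃ x ^ 3 + 8 * deriv c₂ x - 6 * c₃ x * deriv c₃ x -
        4 * iteratedDeriv 2 c₃ x - 8 * c₁ x = 0 ∧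
      1600 * c₀ x - 144 * c₂ x ^ 2 + 11 * c₃ x ^ 4 - 400 * c₃ x * deriv c₂ x +
        288 * c₃ x ^ 2 * deriv c₃ x + 336 * (deriv c₃ x) ^ 2 +
        8 * c₂ x * (c₃ x ^ 2 + 4 * deriv c₃ x) - 480 * iteratedDeriv 2 c₂ x +
        560 * c₃ x * iteratedDeriv 2 c₃ x + 320 * iteratedDeriv 3 c₃ x = 0) ↔
      c₁ x = iterCoeff₁ ρ σ x ∧ c₀ x = iterCoeff₀ ρ σ x := by
  have dρ := hρ.hasDerivAt_iteratedDeriv hI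
  have dσ := hσ.hasDerivAt_iteratedDeriv hI
  have d₃ : ∀ n, ∀ x ∈ I, iteratedDeriv n c₃ x =
      4 * iteratedDeriv n σ x + 6 * iteratedDeriv n ρ x := by
    intro n
    induction n with
    | zero => simpa using h₃
    | succ n ih =>
      rw [iteratedDeriv_succ (f := c₃)]
      exact deriv_eqOn_of_eqOn hI ih fun x hx =>
        ((dσ n x hx).const_mul 4).add ((dρ n x hx).const_mul 6)
  have d₂₁ : ∀ x ∈ I, deriv c₂ x = 6 * iteratedDeriv 2 σ x +
      12 * (iteratedDeriv 0 σ x * iteratedDeriv 1 σ x) + 4 * iteratedDeriv 2 ρ x +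
      18 * (iteratedDeriv 1 ρ x * iteratedDeriv 0 σ x +
        iteratedDeriv 0 ρ x * iteratedDeriv 1 σ x) +
      22 * (iteratedDeriv 0 ρ x * iteratedDeriv 1 ρ x) :=
    deriv_eqOn_of_eqOn (g := fun x => 6 * iteratedDeriv 1 σ x + 6 * iteratedDeriv 0 σ x ^ 2 +
        4 * iteratedDeriv 1 ρ x + 18 * (iteratedDeriv 0 ρ x * iteratedDeriv 0 σ x) +
        11 * iteratedDeriv 0 ρ x ^ 2) hI
      (fun x hx => by rw [h₂ x hx]; simp [iterCoeff₂]; ring)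
      (fun x hx => by
        refine ((((((dσ 1 x hx).const_mul 6).add (((dσ 0 x hx).pow 2).const_mul 6)).add
          ((dρ 1 x hx).const_mul 4)).add (((dρ 0 x hx).mul (dσ 0 x hx)).const_mul 18)).add
          (((dρ 0 x hx).pow 2).const_mul 11)).congr_deriv ?_
        simp
        ring)
  have d₂₂ : ∀ x ∈ I, iteratedDeriv 2 c₂ x = 6 * iteratedDeriv 3 σ x +
      12 * (iteratedDeriv 1 σ x ^ 2 + iteratedDeriv 0 σ x * iteratedDeriv 2 σ x) +
      4 * iteratedDeriv 3 ρ x +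
      18 * (iteratedDeriv 2 ρ x * iteratedDeriv 0 σ x +
        2 * iteratedDeriv 1 ρ x * iteratedDeriv 1 σ x +
        iteratedDeriv 0 ρ x * iteratedDeriv 2 σ x) +
      22 * (iteratedDeriv 1 ρ x ^ 2 + iteratedDeriv 0 ρ x * iteratedDeriv 2 ρ x) := by
    rw [iteratedDeriv_succ, iteratedDeriv_one]
    refine deriv_eqOn_of_eqOn hI d₂₁ fun x hx => ?_
    refine ((((((dσ 2 x hx).const_mul 6).add
      (((dσ 0 x hx).mul (dσ 1 x hx)).const_mul 12)).add ((dρ 2 x hx).const_mul 4)).add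
      ((((dρ 1 x hx).mul (dσ 0 x hx)).add ((dρ 0 x hx).mul (dσ 1 x hx))).const_mul 18)).add
      (((dρ 0 x hx).mul (dρ 1 x hx)).const_mul 22)).congr_deriv ?_
    ring
  intro x hx
  rw [← iteratedDeriv_one (f := c₃), d₃ 1 x hx, d₃ 2 x hx, d₃ 3 x hx, d₂₂ x hx, d₂₁ x hx,
    h₃ x hx, h₂ x hx]
  simp only [iterCoeff₂, iterCoeff₁, iterCoeff₀, iteratedDeriv_zero]
  constructor
  · rintro ⟨h, h'⟩
    exact ⟨by linear_combination (-1 / 8) * h, by linear_combination (1 / 1600) * h'⟩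
  · rintro ⟨h, h'⟩
    exact ⟨by linear_combination (-8) * h, by linear_combination 1600 * h'⟩

/-- A linear combination of derivatives of order at most three at a point is trivial as soon as it
vanishes for all smooth functions. -/
theorem eq_zero_of_forall_contDiff {a₀ a₁ a₂ a₃ x : ℝ}
    (h : ∀ y : ℝ → ℝ, ContDiff ℝ (⊤ : ℕ∞) y → a₃ * iteratedDeriv 3 y x +
      a₂ * iteratedDeriv 2 y x + a₁ * deriv y x + a₀ * y x = 0) :
    a₀ = 0 ∧ a₁ = 0 ∧ a₂ = 0 ∧ a₃ = 0 := by
  have key (k j : ℕ) : iteratedDeriv j (fun t : ℝ => (t - x) ^ k) x =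
      if j = k then (k.factorial : ℝ) else 0 := by
    rw [congrFun (iteratedDeriv_comp_sub_const j (fun t : ℝ => t ^ k) x) x, sub_self,
      iteratedDeriv_fun_pow_zero]
    simp
  have h' (k : ℕ) := h (fun t => (t - x) ^ k) (by fun_prop)
  simp only [← iteratedDeriv_one, key] at h'
  have h₀ := h' 0
  have h₁ := h' 1
  have h₂ := h' 2
  have h₃ := h' 3
  simp [Nat.factorial] at h₀ h₁ h₂ h₃
  exact ⟨h₀, h₁, h₂, h₃⟩

/-- A Riccati equation `D ρ = g - ρ² / 2` with smooth `g` has smooth local solutions, together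
with a primitive. -/
theorem exists_local_solution_riccati {g : ℝ → ℝ} (hg : ContDiff ℝ (⊤ : ℕ∞) g) (x₀ : ℝ) :
    ∃ ε > 0, ∃ R ρ : ℝ → ℝ, ContDiffOn ℝ (⊤ : ℕ∞) R (Set.Ioo (x₀ - ε) (x₀ + ε)) ∧
      ContDiffOn ℝ (⊤ : ℕ∞) ρ (Set.Ioo (x₀ - ε) (x₀ + ε)) ∧
      ∀ x ∈ Set.Ioo (x₀ - ε) (x₀ + ε),
        HasDerivAt R (ρ x) x ∧ HasDerivAt ρ (g x - ρ x ^ 2 / 2) x := by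
  let v : ℝ × ℝ × ℝ → ℝ × ℝ × ℝ := fun p => (1, p.2.2, g p.1 - p.2.2 ^ 2 / 2)
  have hv : ContDiff ℝ (⊤ : ℕ∞) v := by
    unfold v
    fun_prop
  obtain ⟨α, hα₀, ε, hε, hα⟩ :=
    ContDiffAt.exists_forall_mem_closedBall_exists_eq_forall_mem_Ioo_hasDerivAt₀
      (x₀ := ((x₀, 0, 0) : ℝ × ℝ × ℝ)) ((hv.of_le (by exact_mod_cast le_top)).contDiffAt) x₀
  have hs := contDiffOn_of_hasDerivAt_comp isOpen_Ioo hv hα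
  have hfst : ∀ t ∈ Set.Ioo (x₀ - ε) (x₀ + ε), HasDerivAt (fun t => (α t).1) 1 t :=
    fun t ht => (ContinuousLinearMap.fst ℝ ℝ (ℝ × ℝ)).hasFDerivAt.comp_hasDerivAt t (hα t ht)
  have hsnd : ∀ t ∈ Set.Ioo (x₀ - ε) (x₀ + ε), HasDerivAt (fun t => (α t).2)
      ((α t).2.2, g (α t).1 - (α t).2.2 ^ 2 / 2) t :=
    fun t ht => (ContinuousLinearMap.snd ℝ ℝ (ℝ × ℝ)).hasFDerivAt.comp_hasDerivAt t (hα t ht)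
  have h₁ : ∀ t ∈ Set.Ioo (x₀ - ε) (x₀ + ε), (α t).1 = t := by
    have hd : ∀ t ∈ Set.Ioo (x₀ - ε) (x₀ + ε), HasDerivAt (fun t => (α t).1 - t) 0 t := by
      intro t ht
      simpa using (hfst t ht).fun_sub (hasDerivAt_id' t)
    intro t ht
    have := isOpen_Ioo.is_const_of_deriv_eq_zero isPreconnected_Ioo
      (fun t ht => (hd t ht).differentiableAt.differentiableWithinAt)
      (fun t ht => (hd t ht).deriv) ht (show x₀ ∈ Set.Ioo (x₀ - ε) (x₀ + ε) by simp [hε])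
    simp only [hα₀, sub_self] at this
    linarith
  refine ⟨ε, hε, fun t => (α t).2.1, fun t => (α t).2.2, hs.snd.fst, hs.snd.snd,
    fun t ht => ⟨?_, ?_⟩⟩
  · exact (ContinuousLinearMap.fst ℝ ℝ ℝ).hasFDerivAt.comp_hasDerivAt t (hsnd t ht)
  · have h₂ := (ContinuousLinearMap.snd ℝ ℝ ℝ).hasFDerivAt.comp_hasDerivAt t (hsnd t ht)
    rw [h₁ t ht] at h₂
    exact h₂

/-- the fourth-order equation `y'''' + c₃ y''' + c₂ y'' + c₁ y' + c₀ y = 0`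
is iterative (about every point there is an open interval, a smooth nonvanishing `r`
and a smooth `s` with `Ψ⁴ y = r⁴·(y'''' + c₃ y''' + c₂ y'' + c₁ y' + c₀ y)` for all
smooth `y` there) if and only if its coefficients satisfy the two identities
(i) `4 c₂ c₃ − c₃³ + 8 c₂' − 6 c₃ c₃' − 4 c₃'' − 8 c₁ = 0` and
(ii) `1600 c₀ − 144 c₂² + 11 c₃⁴ − 400 c₃ c₂' + 288 c₃² c₃' + 336 (c₃')² +
8 c₂ (c₃² + 4 c₃') − 480 c₂'' + 560 c₃ c₃'' + 320 c₃''' = 0`. -/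
theorem fourth_order_iterative_iff
    (c₀ c₁ c₂ c₃ : ℝ → ℝ)
    (h0 : ContDiff ℝ (⊤ : ℕ∞) c₀) (h1 : ContDiff ℝ (⊤ : ℕ∞) c₁)
    (h2 : ContDiff ℝ (⊤ : ℕ∞) c₂) (h3 : ContDiff ℝ (⊤ : ℕ∞) c₃) :
    (∀ x₀ : ℝ, ∃ l u : ℝ, l < x₀ ∧ x₀ < u ∧
      ∃ r s : ℝ → ℝ, ContDiffOn ℝ (⊤ : ℕ∞) r (Set.Ioo l u) ∧ ContDiffOn ℝ (⊤ : ℕ∞) s (Set.Ioo l u) ∧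
        (∀ x ∈ Set.Ioo l u, r x ≠ 0) ∧
        ∀ y : ℝ → ℝ, ContDiffOn ℝ (⊤ : ℕ∞) y (Set.Ioo l u) →
          ∀ x ∈ Set.Ioo l u,
            (Psi r s)^[4] y x =
              r x ^ 4 *
                (iteratedDeriv 4 y x + c₃ x * iteratedDeriv 3 y x +
                  c₂ x * iteratedDeriv 2 y x + c₁ x * deriv y x + c₀ x * y x)) ↔
    ((∀ x, 4 * c₂ x * c₃ x - c₃ x ^ 3 + 8 * deriv c₂ x - 6 * c₃ x * deriv c₃ x -
        4 * iteratedDeriv 2 c₃ x - 8 * c₁ x = 0) ∧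
      (∀ x, 1600 * c₀ x - 144 * c₂ x ^ 2 + 11 * c₃ x ^ 4 - 400 * c₃ x * deriv c₂ x +
        288 * c₃ x ^ 2 * deriv c₃ x + 336 * (deriv c₃ x) ^ 2 +
        8 * c₂ x * (c₃ x ^ 2 + 4 * deriv c₃ x) - 480 * iteratedDeriv 2 c₂ x +
        560 * c₃ x * iteratedDeriv 2 c₃ x + 320 * iteratedDeriv 3 c₃ x = 0)) := by
  constructor
  · intro H
    refine forall_and.1 fun x₀ => ?_
    obtain ⟨l, u, hl, hu, r, s, hr, hs, hr₀, hy⟩ := H x₀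
    have hI : IsOpen (Set.Ioo l u) := isOpen_Ioo
    have hr' := ((contDiffOn_infty_iff_deriv_of_isOpen hI).1 hr).2
    obtain ⟨ρ, hρ_def⟩ : ∃ ρ : ℝ → ℝ, ρ = fun x => deriv r x / r x := ⟨_, rfl⟩
    obtain ⟨σ, hσ_def⟩ : ∃ σ : ℝ → ℝ, σ = fun x => s x / r x := ⟨_, rfl⟩
    have hρ : ContDiffOn ℝ (⊤ : ℕ∞) ρ (Set.Ioo l u) := hρ_def ▸ hr'.div hr hr₀
    have hσ : ContDiffOn ℝ (⊤ : ℕ∞) σ (Set.Ioo l u) := hσ_def ▸ hs.div hr hr₀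
    have hrd : ∀ x ∈ Set.Ioo l u, HasDerivAt r (ρ x * r x) x := fun x hx => by
      simp only [hρ_def, div_mul_cancel₀ _ (hr₀ x hx)]
      exact ((hr.differentiableOn (by simp)).differentiableAt (hI.mem_nhds hx)).hasDerivAt
    have hsd : ∀ x ∈ Set.Ioo l u, s x = r x * σ x := fun x hx => by
      simp only [hσ_def, mul_div_cancel₀ _ (hr₀ x hx)]
    have hc : ∀ x ∈ Set.Ioo l u, c₀ x - iterCoeff₀ ρ σ x = 0 ∧ c₁ x - iterCoeff₁ ρ σ x = 0 ∧
        c₂ x - iterCoeff₂ ρ σ x = 0 ∧ c₃ x - (4 * σ x + 6 * ρ x) = 0 := fun x hx =>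
      eq_zero_of_forall_contDiff (x := x) fun y hys => by
        have e := (hy y hys.contDiffOn x hx).symm.trans
          (Psi_iterate_four hI hrd hsd hρ hσ hys.contDiffOn x hx)
        linear_combination mul_left_cancel₀ (pow_ne_zero 4 (hr₀ x hx)) e
    exact (identities_iff_eq_iterCoeff hI hρ hσ (fun x hx => sub_eq_zero.1 (hc x hx).2.2.2)
      (fun x hx => sub_eq_zero.1 (hc x hx).2.2.1) x₀ ⟨hl, hu⟩).2
      ⟨sub_eq_zero.1 (hc x₀ ⟨hl, hu⟩).2.1, sub_eq_zero.1 (hc x₀ ⟨hl, hu⟩).1⟩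
  · rintro ⟨hi, hii⟩ x₀
    have h3' : ContDiff ℝ (⊤ : ℕ∞) (deriv c₃) := (contDiff_infty_iff_deriv.1 h3).2
    obtain ⟨ε, hε, R, ρ, hR, hρ, hd⟩ := exists_local_solution_riccati
      (g := fun x => (3 / 2 * deriv c₃ x + 3 / 8 * c₃ x ^ 2 - c₂ x) / 5) (by fun_prop) x₀
    have hI : IsOpen (Set.Ioo (x₀ - ε) (x₀ + ε)) := isOpen_Ioo
    have hσ : ContDiffOn ℝ (⊤ : ℕ∞) (fun x => (c₃ x - 6 * ρ x) / 4)
        (Set.Ioo (x₀ - ε) (x₀ + ε)) :=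
      (h3.contDiffOn.sub (contDiffOn_const.mul hρ)).div_const 4
    have e₃ : ∀ x ∈ Set.Ioo (x₀ - ε) (x₀ + ε),
        c₃ x = 4 * ((c₃ x - 6 * ρ x) / 4) + 6 * ρ x := fun x _ => by ring
    have e₂ : ∀ x ∈ Set.Ioo (x₀ - ε) (x₀ + ε),
        c₂ x = iterCoeff₂ ρ (fun x => (c₃ x - 6 * ρ x) / 4) x := fun x hx => by
      have hc₃ : HasDerivAt c₃ (deriv c₃ x) x :=
        (h3.differentiable (by simp)).differentiableAt.hasDerivAt
      have hσ' : deriv (fun x => (c₃ x - 6 * ρ x) / 4) x = _ :=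
        ((hc₃.sub ((hd x hx).2.const_mul 6)).div_const 4).deriv
      simp only [iterCoeff₂, iteratedDeriv_one, hσ', (hd x hx).2.deriv]
      ring
    have hr : ∀ x ∈ Set.Ioo (x₀ - ε) (x₀ + ε),
        HasDerivAt (fun x => Real.exp (R x)) (ρ x * Real.exp (R x)) x := fun x hx =>
      (hd x hx).1.exp.congr_deriv (mul_comm _ _)
    refine ⟨x₀ - ε, x₀ + ε, by linarith, by linarith, fun x => Real.exp (R x),
      fun x => Real.exp (R x) * ((c₃ x - 6 * ρ x) / 4), hR.exp, hR.exp.mul hσ,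
      fun x _ => (Real.exp_pos _).ne', fun y hy x hx => ?_⟩
    obtain ⟨e₁, e₀⟩ := (identities_iff_eq_iterCoeff hI hρ hσ e₃ e₂ x hx).1 ⟨hi x, hii x⟩
    rw [Psi_iterate_four hI hr (fun _ _ => rfl) hρ hσ hy x hx, ← e₃ x hx, ← e₂ x hx, ← e₁,
      ← e₀]
end
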